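/- arXiv:2105.11224 — 2 statements merged into one kernel-verified Lean document; each statement's English description precedes it below -/
import Mathlib

section
/- If ϑ_P = (ϑ, P) is a random substitution over a finite alphabet A and X ⊂ A^Z is compact, then ϑ(X) is compact, where ϑ(X) = ∪_{x ∈ X} ϑ(x) and for x ∈ A^Z, ϑ(x) denotes the set of bi-infinite sequences ⋯v_{−1}.v_0 v_1⋯ with v_j ∈ ϑ(x_j) for all j ∈ Z. -/
open Filter MeasureTheory

namespace RandomSubstitutionTheory

variable {A : Type*} [Fintype A] [DecidableEq A]

/-- The set of realisations of `ϑ(u)` for a word `u`. -/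
def reals (θ : A → Finset (List A)) : List A → Finset (List A)
  | [] => {[]}
  | a :: u => (θ a).biUnion fun v => (reals θ u).image fun w => v ++ w

/-- The set of realisations of `ϑ^n(u)` for a word `u`. -/
def realsIter (θ : A → Finset (List A)) : ℕ → List A → Finset (List A)
  | 0, u => {u}
  | n + 1, u => (reals θ u).biUnion fun v => realsIter θ n v

/-- `wordProb θ P u w` is the probability `P[ϑ_P(u) = w]`, each letter of `u` being
substituted independently. -/
noncomputable def wordProb (θ : A → Finset (List A)) (P : A → List A → ℝ) :
    List A → List A → ℝ
  | [], w => if w = [] then 1 else 0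
  | a :: u, w =>
      ∑ v ∈ θ a, P a v * (if v <+: w then wordProb θ P u (w.drop v.length) else 0)

/-- `iterProb θ P n u w` is the probability `P[ϑ_P^n(u) = w]` of the induced Markov chain. -/
noncomputable def iterProb (θ : A → Finset (List A)) (P : A → List A → ℝ) :
    ℕ → List A → List A → ℝ
  | 0, u, w => if u = w then 1 else 0
  | n + 1, u, w => ∑ v ∈ reals θ u, wordProb θ P u v * iterProb θ P n v w

/-- The substitution matrix `M_{ij} = E[|ϑ_P(a_j)|_{a_i}]`. -/
noncomputable def substM (θ : A → Finset (List A)) (P : A → List A → ℝ) :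
    Matrix A A ℝ :=
  Matrix.of fun i j => ∑ w ∈ θ j, P j w * (w.count i : ℝ)

/-- The defining data of a random substitution: nonempty finite sets of nonempty words
and strictly positive probability vectors. -/
def IsRandomSubstitution (θ : A → Finset (List A)) (P : A → List A → ℝ) : Prop :=
  (∀ a, (θ a).Nonempty) ∧ (∀ a, ∀ w ∈ θ a, w ≠ []) ∧
    (∀ a, ∀ w ∈ θ a, 0 < P a w) ∧ (∀ a w, w ∉ θ a → P a w = 0) ∧
    ∀ a, ∑ w ∈ θ a, P a w = 1

/-- Primitivity of the substitution matrix: some power has strictly positive entries. -/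
def IsPrimitive (θ : A → Finset (List A)) (P : A → List A → ℝ) : Prop :=
  ∃ k : ℕ, ∀ i j : A, 0 < (substM θ P ^ k) i j

/-- The Perron–Frobenius eigenvalue is `> 1` (witnessed by a positive right eigenvector). -/
def IsExpanding (θ : A → Finset (List A)) (P : A → List A → ℝ) : Prop :=
  ∃ lam : ℝ, 1 < lam ∧ ∃ R : A → ℝ, (∀ a, 0 < R a) ∧ (substM θ P).mulVec R = lam • R

/-- A word is legal if it occurs as a subword of some level-`k` inflation word. -/
def Legal (θ : A → Finset (List A)) (u : List A) : Prop :=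
  ∃ (a : A) (k : ℕ) (w : List A), w ∈ realsIter θ k [a] ∧ u <:+: w

/-- All words of length `n` over the alphabet. -/
def allWords (A : Type*) [Fintype A] [DecidableEq A] (n : ℕ) : Finset (List A) :=
  (Finset.univ : Finset (Fin n → A)).image List.ofFn

/-- All legal words of length `n`. -/
noncomputable def legalWords (θ : A → Finset (List A)) (n : ℕ) : Finset (List A) :=
  letI := Classical.decPred (Legal θ)
  (allWords A n).filter (Legal θ)

/-- The left shift on bi-infinite sequences. -/
def shift : (ℤ → A) → ℤ → A := fun x i => x (i + 1)

/-- The finite word of length `n` read off a bi-infinite sequence starting at position `m`. -/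
def window (x : ℤ → A) (m : ℤ) (n : ℕ) : List A :=
  (List.range n).map fun t => x (m + (t : ℤ))

/-- The random substitution subshift `X_ϑ`. -/
def Xtheta (θ : A → Finset (List A)) : Set (ℤ → A) :=
  {x | ∀ (m : ℤ) (n : ℕ), Legal θ (window x m n)}

/-- The cylinder set of the word `v` at position `m`. -/
def cylinder (v : List A) (m : ℤ) : Set (ℤ → A) :=
  {x | window x m v.length = v}

/-- The number `|w|_v` of (possibly overlapping) occurrences of `v` in `w`. -/
def occCount (v w : List A) : ℕ :=
  ((List.range w.length).filter fun i => decide (v <+: w.drop i)).length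

/-- Expected length `E[|ϑ_P^k(a)|]`. -/
noncomputable def expLen (θ : A → Finset (List A)) (P : A → List A → ℝ)
    (k : ℕ) (a : A) : ℝ :=
  ∑ w ∈ realsIter θ k [a], iterProb θ P k [a] w * (w.length : ℝ)

/-- Expected number of occurrences `E[|ϑ_P^k(a)|_v]`. -/
noncomputable def expCount (θ : A → Finset (List A)) (P : A → List A → ℝ)
    (k : ℕ) (a : A) (v : List A) : ℝ :=
  ∑ w ∈ realsIter θ k [a], iterProb θ P k [a] w * (occCount v w : ℝ)

/-- `μ` is the frequency measure of `(ϑ, P)`: a shift-invariant Borel probability measure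
supported on `X_ϑ` whose cylinder values are the expected word frequencies. -/
def IsFrequencyMeasure [MeasurableSpace A] (θ : A → Finset (List A))
    (P : A → List A → ℝ) (μ : Measure (ℤ → A)) : Prop :=
  IsProbabilityMeasure μ ∧
    (∀ s : Set (ℤ → A), MeasurableSet s → μ (shift ⁻¹' s) = μ s) ∧
    μ (Xtheta θ) = 1 ∧
    ∀ v : List A, Legal θ v → ∀ (m : ℤ) (a : A),
      Tendsto (fun k : ℕ => expCount θ P k a v / expLen θ P k a) atTop
        (nhds ((μ (cylinder v m)).toReal))

/-- The `n`-th entropy sum `∑_{u ∈ L_ϑ^n} -μ[u] log μ[u]`. -/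
noncomputable def entropySeq [MeasurableSpace A] (θ : A → Finset (List A))
    (μ : Measure (ℤ → A)) (n : ℕ) : ℝ :=
  ∑ u ∈ legalWords θ n, Real.negMulLog ((μ (cylinder u 0)).toReal)

/-- The measure-theoretic (Kolmogorov–Sinai) entropy of the shift with respect to `μ`,
computed along cylinder partitions. -/
noncomputable def measEntropy [MeasurableSpace A] (θ : A → Finset (List A))
    (μ : Measure (ℤ → A)) : ℝ :=
  limsup (fun n : ℕ => entropySeq θ μ n / (n : ℝ)) atTop

/-- The topological entropy of the subshift `X_ϑ`. -/
noncomputable def topEntropy (θ : A → Finset (List A)) : ℝ :=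
  limsup (fun n : ℕ => Real.log ((legalWords θ n).card) / (n : ℝ)) atTop

/-- The entropy vector `H_{k,a} = H(ϑ_P^k(a))`. -/
noncomputable def Hvec (θ : A → Finset (List A)) (P : A → List A → ℝ)
    (k : ℕ) (a : A) : ℝ :=
  ∑ w ∈ realsIter θ k [a], Real.negMulLog (iterProb θ P k [a] w)

/-- The inner product `H_k^T R`. -/
noncomputable def HdotR (θ : A → Finset (List A)) (P : A → List A → ℝ)
    (R : A → ℝ) (k : ℕ) : ℝ :=
  ∑ a, Hvec θ P k a * R a

/-- Binary entropy `H(p) = -p log p - (1-p) log (1-p)`. -/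
noncomputable def binEnt (p : ℝ) : ℝ := Real.negMulLog p + Real.negMulLog (1 - p)

/-- Unique realisation paths: concatenation of level-`k` inflation words of the letters of a
legal word is injective. -/
def UniqueRealisationPaths (θ : A → Finset (List A)) : Prop :=
  ∀ v : List A, Legal θ v → ∀ k : ℕ, ∀ f g : Fin v.length → List A,
    (∀ i, f i ∈ realsIter θ k [v.get i]) → (∀ i, g i ∈ realsIter θ k [v.get i]) →
      (List.ofFn f).flatten = (List.ofFn g).flatten → f = g

/-- The disjoint set condition. -/
def DisjointSetCondition (θ : A → Finset (List A)) : Prop :=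
  ∀ (a : A) (k : ℕ), ∀ u ∈ θ a, ∀ v ∈ θ a, u ≠ v →
    ∀ w, w ∈ realsIter θ k u → w ∉ realsIter θ k v

/-- The identical set condition. -/
def IdenticalSetCondition (θ : A → Finset (List A)) : Prop :=
  ∀ (a : A) (k : ℕ), ∀ u ∈ θ a, ∀ v ∈ θ a, realsIter θ k u = realsIter θ k v

/-- Identical production probabilities. -/
def IdenticalProductionProbabilities (θ : A → Finset (List A))
    (P : A → List A → ℝ) : Prop :=
  ∀ a : A, ∀ u ∈ θ a, ∀ v ∈ θ a, ∀ (k : ℕ) (w : List A),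
    iterProb θ P k u w = iterProb θ P k v w

/-- The disjoint set condition for the `k`-th power `ϑ^k`. -/
def DisjointSetConditionPow (θ : A → Finset (List A)) (k : ℕ) : Prop :=
  ∀ (a : A) (j : ℕ), ∀ u ∈ realsIter θ k [a], ∀ v ∈ realsIter θ k [a], u ≠ v →
    ∀ w, w ∈ realsIter θ (k * j) u → w ∉ realsIter θ (k * j) v

/-- The identical set condition for the `k`-th power `ϑ^k`. -/
def IdenticalSetConditionPow (θ : A → Finset (List A)) (k : ℕ) : Prop :=
  ∀ (a : A) (j : ℕ), ∀ u ∈ realsIter θ k [a], ∀ v ∈ realsIter θ k [a],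
    realsIter θ (k * j) u = realsIter θ (k * j) v

/-- Identical production probabilities for the `k`-th power `ϑ^k`. -/
def IdenticalProductionProbabilitiesPow (θ : A → Finset (List A))
    (P : A → List A → ℝ) (k : ℕ) : Prop :=
  ∀ a : A, ∀ u ∈ realsIter θ k [a], ∀ v ∈ realsIter θ k [a], ∀ (j : ℕ) (w : List A),
    iterProb θ P (k * j) u w = iterProb θ P (k * j) v w

/-- Compatibility: all realisations of a letter have the same abelianisation. -/
def Compatible (θ : A → Finset (List A)) : Prop :=
  ∀ a : A, ∀ u ∈ θ a, ∀ v ∈ θ a, ∀ b : A, u.count b = v.count b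

/-- Constant length `ℓ ≥ 2`. -/
def ConstantLength (θ : A → Finset (List A)) (ℓ : ℕ) : Prop :=
  2 ≤ ℓ ∧ ∀ a : A, ∀ w ∈ θ a, w.length = ℓ

/-- The set `ϑ(y)` of bi-infinite sequences obtained by substituting each letter of `y`,
with the image of `y 0` beginning at position `0`. -/
def substSeq (θ : A → Finset (List A)) (y : ℤ → A) : Set (ℤ → A) :=
  {x | ∃ v : ℤ → List A, (∀ j, v j ∈ θ (y j)) ∧
    ∃ p : ℤ → ℤ, p 0 = 0 ∧ (∀ j, p (j + 1) = p j + (v j).length) ∧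
      ∀ (j : ℤ) (t : ℕ) (ht : t < (v j).length), x (p j + (t : ℤ)) = (v j).get ⟨t, ht⟩}

/-- `ϑ(X)` for a set of bi-infinite sequences. -/
def substImage (θ : A → Finset (List A)) (X : Set (ℤ → A)) : Set (ℤ → A) :=
  ⋃ y ∈ X, substSeq θ y

/-- The set `ϑ^m(y)` of bi-infinite sequences. -/
def substSeqPow (θ : A → Finset (List A)) : ℕ → (ℤ → A) → Set (ℤ → A)
  | 0, y => {y}
  | m + 1, y => ⋃ z ∈ substSeq θ y, substSeqPow θ m z

/-- The maximal length of an inflation word of the letter `a` (equals the common length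
when lengths are well-defined). -/
def maxLen (θ : A → Finset (List A)) (a : A) : ℕ := (θ a).sup List.length

/-- Recognisability: every `x ∈ X_ϑ` has a unique inflation-word decomposition. -/
def Recognisable (θ : A → Finset (List A)) : Prop :=
  ∀ x ∈ Xtheta θ, ∃! p : (ℤ → A) × ℕ,
    p.1 ∈ Xtheta θ ∧ p.2 < maxLen θ (p.1 0) ∧
      (fun i => x (i - (p.2 : ℤ))) ∈ substSeq θ p.1

/-- Recognisability of the `m`-th power of a constant length-`ℓ` substitution. -/
def RecognisablePow (θ : A → Finset (List A)) (m ℓ : ℕ) : Prop :=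
  ∀ x ∈ Xtheta θ, ∃! p : (ℤ → A) × ℕ,
    p.1 ∈ Xtheta θ ∧ p.2 < ℓ ^ m ∧
      (fun i => x (i - (p.2 : ℤ))) ∈ substSeqPow θ m p.1

/-- The set `ϑ^m([a])` of exact images of sequences in the cylinder `[a] ⊆ X_ϑ`. -/
def inflCylPow (θ : A → Finset (List A)) (m : ℕ) (a : A) : Set (ℤ → A) :=
  ⋃ y ∈ {w ∈ Xtheta θ | w 0 = a}, substSeqPow θ m y

/-- `r` is a radius of local recognisability for `ϑ^m`. -/
def RecogPropPow (θ : A → Finset (List A)) (m r : ℕ) : Prop :=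
  ∀ (a : A) (x : ℤ → A), x ∈ inflCylPow θ m a → ∀ y ∈ Xtheta θ,
    (∀ t : ℤ, -(r : ℤ) ≤ t → t ≤ (r : ℤ) → x t = y t) → y ∈ inflCylPow θ m a

/-- The recognisability radius `κ(ϑ^m)`. -/
noncomputable def recogRadiusPow (θ : A → Finset (List A)) (m : ℕ) : ℕ :=
  sInf {r | RecogPropPow θ m r}

/-- The recognisability radius `κ(ϑ)`. -/
noncomputable def recogRadius (θ : A → Finset (List A)) : ℕ := recogRadiusPow θ 1

/-- The random word `ϑ_P^n(a)` is (a.s.) completely determined by `ϑ_P^{n+k}(a)`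
in the Markov chain. -/
def DeterminedBy (θ : A → Finset (List A)) (P : A → List A → ℝ)
    (a : A) (n k : ℕ) : Prop :=
  ∀ v₁ v₂ w : List A, v₁ ∈ realsIter θ n [a] → v₂ ∈ realsIter θ n [a] →
    0 < iterProb θ P n [a] v₁ * iterProb θ P k v₁ w →
      0 < iterProb θ P n [a] v₂ * iterProb θ P k v₂ w → v₁ = v₂

/-- The random words `ϑ_P^n(a)` and `ϑ_P^{n+k}(a)` are independent in the Markov chain. -/
def IndepSteps (θ : A → Finset (List A)) (P : A → List A → ℝ)
    (a : A) (n k : ℕ) : Prop :=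
  ∀ v w : List A,
    iterProb θ P n [a] v * iterProb θ P k v w =
      iterProb θ P n [a] v * iterProb θ P (n + k) [a] w

/-- The substitution matrix of a marginal (deterministic) substitution. -/
def marginalM (ρ : A → List A) : Matrix A A ℝ :=
  Matrix.of fun i j => ((ρ j).count i : ℝ)

/-- Geometric compatibility: a single positive left eigenvector with eigenvalue `λ > 1`
for all marginals. -/
def GeometricallyCompatible (θ : A → Finset (List A)) : Prop :=
  ∃ lam : ℝ, 1 < lam ∧ ∃ L : A → ℝ, (∀ a, 0 < L a) ∧
    ∀ ρ : A → List A, (∀ a, ρ a ∈ θ a) → Matrix.vecMul L (marginalM ρ) = lam • L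


/-- A cumulative sum starting at `0` with increments in `[0, L]` satisfies `|p j| ≤ L * |j|`. -/
theorem abs_le_mul_abs_of_increments {p : ℤ → ℤ} {ℓ : ℤ → ℕ} {L : ℕ} (hℓ : ∀ j, ℓ j ≤ L)
    (h0 : p 0 = 0) (hp : ∀ j, p (j + 1) = p j + ℓ j) (j : ℤ) : |p j| ≤ L * |j| := by
  induction j with
  | zero => simp [h0]
  | succ i ih =>
    have h1 := hp i
    have h2 : (ℓ i : ℤ) ≤ L := by exact_mod_cast hℓ i
    have h3 : |(i : ℤ) + 1| = i + 1 := abs_of_nonneg (by positivity)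
    rw [Nat.abs_cast, abs_le] at ih
    rw [h3, abs_le, mul_add]
    constructor <;> linarith [ih.1, ih.2]
  | pred i ih =>
    have h1 := hp (-i - 1)
    rw [sub_add_cancel] at h1
    have h2 : (ℓ (-i - 1) : ℤ) ≤ L := by exact_mod_cast hℓ _
    have h3 : |-(i : ℤ) - 1| = i + 1 := by
      rw [← neg_add', abs_neg]
      exact abs_of_nonneg (by positivity)
    rw [abs_neg, Nat.abs_cast, abs_le] at ih
    rw [h3, abs_le, mul_add]
    constructor <;> linarith [ih.1, ih.2]

/-- Evaluation of a sequence at a position is jointly continuous. -/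
theorem continuous_eval_int {B : Type*} [TopologicalSpace B] :
    Continuous fun z : (ℤ → B) × ℤ => z.1 z.2 :=
  continuous_prod_of_discrete_right.2 fun n => continuous_apply n

/-- The tuples `(y, v, p, x)` such that `x` is the concatenation of the words `word (v j)`,
starting at the positions `p j`, with `word (v j) ∈ θ (y j)`. -/
def concatenationGraph {B W : Type*} (θ : B → Finset (List B)) (word : W → List B)
    (X : Set (ℤ → B)) : Set ((ℤ → B) × (ℤ → W) × (ℤ → ℤ) × (ℤ → B)) :=
  {z | z.1 ∈ X ∧ (∀ j, word (z.2.1 j) ∈ θ (z.1 j)) ∧ z.2.2.1 0 = 0 ∧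
    (∀ j, z.2.2.1 (j + 1) = z.2.2.1 j + (word (z.2.1 j)).length) ∧
    ∀ (j : ℤ) (w : W) (t : ℕ) (ht : t < (word w).length),
      z.2.1 j ≠ w ∨ z.2.2.2 (z.2.2.1 j + (t : ℤ)) = (word w).get ⟨t, ht⟩}

theorem isClosed_concatenationGraph {B W : Type*} [TopologicalSpace B] [DiscreteTopology B]
    [TopologicalSpace W] [DiscreteTopology W] (θ : B → Finset (List B)) (word : W → List B)
    {X : Set (ℤ → B)} (hX : IsClosed X) : IsClosed (concatenationGraph θ word X) := by
  have hv (j : ℤ) : Continuous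
      fun z : (ℤ → B) × (ℤ → W) × (ℤ → ℤ) × (ℤ → B) => z.2.1 j := by fun_prop
  have hp (j : ℤ) : Continuous
      fun z : (ℤ → B) × (ℤ → W) × (ℤ → ℤ) × (ℤ → B) => z.2.2.1 j := by fun_prop
  simp only [concatenationGraph, Set.ofPred_and, Set.ofPred_forall]
  refine (hX.preimage continuous_fst).inter (IsClosed.inter ?_ (IsClosed.inter ?_
    (IsClosed.inter ?_ ?_)))
  · exact isClosed_iInter fun j => (isClosed_discrete {q : W × B | word q.1 ∈ θ q.2}).preimage
      ((hv j).prodMk ((continuous_apply j).comp continuous_fst))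
  · exact isClosed_eq (hp 0) continuous_const
  · refine isClosed_iInter fun j => isClosed_eq (hp (j + 1)) ((hp j).add ?_)
    exact (continuous_of_discreteTopology (f := fun w : W => ((word w).length : ℤ))).comp (hv j)
  · refine isClosed_iInter fun j => isClosed_iInter fun w => isClosed_iInter fun t =>
      isClosed_iInter fun ht => IsClosed.union ?_ (isClosed_eq ?_ continuous_const)
    · exact (isClosed_discrete {w}ᶜ).preimage (hv j)
    · exact continuous_eval_int.comp
        ((continuous_snd.comp (continuous_snd.comp continuous_snd)).prodMk
          ((hp j).add continuous_const))

theorem isCompact_concatenationGraph {B W : Type*} [Finite B] [TopologicalSpace B]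
    [DiscreteTopology B] [Finite W] [TopologicalSpace W] [DiscreteTopology W]
    (θ : B → Finset (List B)) (word : W → List B)
    {X : Set (ℤ → B)} (hX : IsCompact X) : IsCompact (concatenationGraph θ word X) := by
  obtain ⟨L, hL⟩ := (Set.finite_range fun w => (word w).length).bddAbove
  have hbox : IsCompact (X ×ˢ (Set.univ : Set (ℤ → W)) ×ˢ
      (Set.univ.pi fun j : ℤ => Set.Icc (-((L : ℤ) * |j|)) (L * |j|)) ×ˢ
        (Set.univ : Set (ℤ → B))) :=
    hX.prod (isCompact_univ.prod
      ((isCompact_univ_pi fun _ => isCompact_Icc).prod isCompact_univ))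
  refine hbox.of_isClosed_subset (isClosed_concatenationGraph θ word hX.isClosed) ?_
  rintro ⟨y, v, p, x⟩ ⟨hy, -, h0, hp, -⟩
  refine ⟨hy, trivial, fun j _ => abs_le.1 ?_, trivial⟩
  exact abs_le_mul_abs_of_increments (fun j => hL ⟨v j, rfl⟩) h0 hp j

theorem substImage_eq_image_concatenationGraph {B W : Type*}
    (θ : B → Finset (List B)) (word : W → List B)
    (hword : ∀ a, ∀ u ∈ θ a, u ∈ Set.range word) (X : Set (ℤ → B)) :
    substImage θ X = Set.image (fun z => z.2.2.2) (concatenationGraph θ word X) := by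
  ext x
  simp only [substImage, substSeq, Set.mem_iUnion, Set.mem_image, Set.mem_ofPred_eq, exists_prop]
  constructor
  · rintro ⟨y, hy, v, hv, p, h0, hp, hx⟩
    choose c hc using fun j => hword _ _ (hv j)
    obtain rfl : v = fun j => word (c j) := funext fun j => (hc j).symm
    refine ⟨(y, c, p, x), ⟨hy, hv, h0, hp, fun j w t ht => ?_⟩, rfl⟩
    by_cases h : c j = w
    · subst h
      exact Or.inr (hx j t ht)
    · exact Or.inl h
  · rintro ⟨⟨y, c, p, x⟩, ⟨hy, hv, h0, hp, hx⟩, rfl⟩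
    exact ⟨y, hy, fun j => word (c j), hv, p, h0, hp,
      fun j t ht => (hx j (c j) t ht).resolve_left fun h => h rfl⟩

theorem statement6 {A : Type*} [Fintype A] [DecidableEq A]
    [TopologicalSpace A] [DiscreteTopology A]
    (θ : A → Finset (List A)) (P : A → List A → ℝ)
    (hRS : IsRandomSubstitution θ P)
    (X : Set (ℤ → A)) (hX : IsCompact X) :
    IsCompact (substImage θ X) := by
  let e := (Finset.univ.biUnion θ).equivFin
  rw [substImage_eq_image_concatenationGraph θ (fun i => (e.symm i : List A))
    (fun a u hu => ⟨e ⟨u, Finset.mem_biUnion.2 ⟨a, Finset.mem_univ a, hu⟩⟩, by simp⟩)]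
  exact (isCompact_concatenationGraph θ _ hX).image (by fun_prop)

end RandomSubstitutionTheory
end

section
/- Let ϑ_P be a primitive random substitution with Perron–Frobenius eigenvalue λ, right Perron–Frobenius eigenvector R and frequency measure μ_P. Then for every k ∈ N, h(μ_P) ≤ (λ^k − 1)^{-1}·H_k^T R. -/
open Filter MeasureTheory

namespace RandomSubstitutionTheory

variable {A : Type*} [Fintype A] [DecidableEq A]

/-- The expectation of `g` under the law of `ϑ_P(u)`. -/
noncomputable def wordExp (θ : A → Finset (List A)) (P : A → List A → ℝ) (u : List A)
    (g : List A → ℝ) : ℝ :=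
  ∑ v ∈ reals θ u, wordProb θ P u v * g v

/-- The expectation of `g` under the law of `ϑ_P^n(u)`. -/
noncomputable def iterExp (θ : A → Finset (List A)) (P : A → List A → ℝ) (n : ℕ) (u : List A)
    (g : List A → ℝ) : ℝ :=
  ∑ w ∈ realsIter θ n u, iterProb θ P n u w * g w

/-- The additive functional on words induced by a function on letters. -/
def letterSum (φ : A → ℝ) (w : List A) : ℝ := (w.map φ).sum

section Expectation

set_option linter.unusedSectionVars false

variable {θ : A → Finset (List A)} {P : A → List A → ℝ}

lemma append_mem_reals {a : A} {u v y : List A} (hv : v ∈ θ a) (hy : y ∈ reals θ u) :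
    v ++ y ∈ reals θ (a :: u) := by
  simp only [reals, Finset.mem_biUnion, Finset.mem_image]
  exact ⟨v, hv, y, hy, rfl⟩

lemma wordProb_eq_zero {u w : List A} (hw : w ∉ reals θ u) : wordProb θ P u w = 0 := by
  induction u generalizing w with
  | nil =>
    have : w ≠ [] := by simpa [reals] using hw
    simp [wordProb, this]
  | cons a u ih =>
    rw [wordProb]
    refine Finset.sum_eq_zero fun v hv => ?_
    split_ifs with h
    · obtain ⟨y, rfl⟩ := h
      rw [List.drop_left, ih fun hy => hw (append_mem_reals hv hy), mul_zero]
    · rw [mul_zero]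

lemma wordExp_cons (a : A) (u : List A) (g : List A → ℝ) :
    wordExp θ P (a :: u) g = ∑ v ∈ θ a, P a v * wordExp θ P u fun y => g (v ++ y) := by
  simp only [wordExp, wordProb, Finset.sum_mul]
  rw [Finset.sum_comm]
  refine Finset.sum_congr rfl fun v hv => ?_
  simp only [mul_assoc, ← Finset.mul_sum]
  congr 1
  have hsub : (reals θ u).image (fun y => v ++ y) ⊆ reals θ (a :: u) := by
    intro w hw
    obtain ⟨y, hy, rfl⟩ := Finset.mem_image.1 hw
    exact append_mem_reals hv hy
  rw [← Finset.sum_subset hsub, Finset.sum_image (by simp)]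
  · simp
  · intro w _ hw
    split_ifs with h
    · obtain ⟨y, rfl⟩ := h
      have hy : y ∉ reals θ u := fun hy => hw (Finset.mem_image_of_mem _ hy)
      rw [List.drop_left, wordProb_eq_zero hy, zero_mul]
    · rw [zero_mul]

lemma wordExp_append (u v : List A) (g : List A → ℝ) :
    wordExp θ P (u ++ v) g = wordExp θ P u fun x => wordExp θ P v fun y => g (x ++ y) := by
  induction u generalizing g with
  | nil => simp [wordExp, reals, wordProb]
  | cons a u ih => simp only [List.cons_append, wordExp_cons, ih, List.append_assoc]

lemma iterProb_eq_zero {n : ℕ} {u w : List A} (hw : w ∉ realsIter θ n u) :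
    iterProb θ P n u w = 0 := by
  induction n generalizing u with
  | zero =>
    have : u ≠ w := by simpa [realsIter, eq_comm] using hw
    simp [iterProb, this]
  | succ n ih =>
    rw [iterProb]
    refine Finset.sum_eq_zero fun v hv => ?_
    rw [ih fun h => hw ?_, mul_zero]
    exact Finset.mem_biUnion.2 ⟨v, hv, h⟩

lemma iterExp_zero (u : List A) (g : List A → ℝ) : iterExp θ P 0 u g = g u := by
  simp [iterExp, realsIter, iterProb]

lemma iterExp_succ (n : ℕ) (u : List A) (g : List A → ℝ) :
    iterExp θ P (n + 1) u g = wordExp θ P u fun v => iterExp θ P n v g := by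
  simp only [iterExp, wordExp, iterProb, Finset.sum_mul]
  rw [Finset.sum_comm]
  refine Finset.sum_congr rfl fun v hv => ?_
  simp only [mul_assoc, ← Finset.mul_sum]
  congr 1
  refine (Finset.sum_subset (fun w hw => Finset.mem_biUnion.2 ⟨v, hv, hw⟩) ?_).symm
  intro w _ hw
  rw [iterProb_eq_zero hw, zero_mul]

lemma iterExp_nil (n : ℕ) (g : List A → ℝ) : iterExp θ P n [] g = g [] := by
  induction n with
  | zero => exact iterExp_zero _ _
  | succ n ih => simpa [iterExp_succ, wordExp, reals, wordProb] using ih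

lemma iterExp_add (m n : ℕ) (u : List A) (g : List A → ℝ) :
    iterExp θ P (m + n) u g = iterExp θ P m u fun v => iterExp θ P n v g := by
  induction m generalizing u with
  | zero => rw [Nat.zero_add, iterExp_zero]
  | succ m ih => simp only [Nat.succ_add, ← Nat.add_one, iterExp_succ, ih]

lemma iterExp_append (n : ℕ) (u v : List A) (g : List A → ℝ) :
    iterExp θ P n (u ++ v) g =
      iterExp θ P n u fun x => iterExp θ P n v fun y => g (x ++ y) := by
  induction n generalizing u v g with
  | zero => simp only [iterExp_zero]
  | succ n ih =>
    simp only [iterExp_succ, wordExp_append, ih]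
    simp only [wordExp, iterExp, Finset.mul_sum]
    refine Finset.sum_congr rfl fun x _ => ?_
    rw [Finset.sum_comm]
    refine Finset.sum_congr rfl fun x' _ => Finset.sum_congr rfl fun y _ =>
      Finset.sum_congr rfl fun y' _ => ?_
    ring

lemma iterExp_cons (n : ℕ) (b : A) (v : List A) (g : List A → ℝ) :
    iterExp θ P n (b :: v) g =
      iterExp θ P n [b] fun x => iterExp θ P n v fun y => g (x ++ y) :=
  iterExp_append n [b] v g

lemma iterExp_linear (n : ℕ) (u : List A) (s t : ℝ) (g h : List A → ℝ) :
    iterExp θ P n u (fun w => s * g w + t * h w) =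
      s * iterExp θ P n u g + t * iterExp θ P n u h := by
  simp only [iterExp, mul_add, Finset.sum_add_distrib, Finset.mul_sum, mul_left_comm]

lemma iterExp_add_fun (n : ℕ) (u : List A) (g h : List A → ℝ) :
    iterExp θ P n u (fun w => g w + h w) = iterExp θ P n u g + iterExp θ P n u h := by
  simpa using iterExp_linear (θ := θ) (P := P) n u 1 1 g h

lemma iterProb_eq_iterExp (n : ℕ) (u w : List A) :
    iterProb θ P n u w = iterExp θ P n u fun v => if v = w then 1 else 0 := by
  simp only [iterExp, mul_ite, mul_one, mul_zero, Finset.sum_ite_eq']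
  split_ifs with h
  · rfl
  · exact iterProb_eq_zero h

lemma wordProb_nonneg (hP : ∀ a, ∀ w ∈ θ a, 0 ≤ P a w) (u w : List A) :
    0 ≤ wordProb θ P u w := by
  induction u generalizing w with
  | nil => rw [wordProb]; split_ifs <;> norm_num
  | cons a u ih =>
    rw [wordProb]
    refine Finset.sum_nonneg fun v hv => mul_nonneg (hP a v hv) ?_
    split_ifs
    · exact ih _
    · exact le_rfl

lemma iterProb_nonneg (hP : ∀ a, ∀ w ∈ θ a, 0 ≤ P a w) (n : ℕ) (u w : List A) :
    0 ≤ iterProb θ P n u w := by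
  induction n generalizing u with
  | zero => rw [iterProb]; split_ifs <;> norm_num
  | succ n ih =>
    rw [iterProb]
    exact Finset.sum_nonneg fun v _ => mul_nonneg (wordProb_nonneg hP u v) (ih v)

lemma iterExp_mono (hP : ∀ a, ∀ w ∈ θ a, 0 ≤ P a w) {n : ℕ} {u : List A} {g h : List A → ℝ}
    (hgh : ∀ w ∈ realsIter θ n u, 0 < iterProb θ P n u w → g w ≤ h w) :
    iterExp θ P n u g ≤ iterExp θ P n u h := by
  refine Finset.sum_le_sum fun w hw => ?_
  rcases (iterProb_nonneg hP n u w).eq_or_lt with h0 | h0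
  · simp [← h0]
  · exact mul_le_mul_of_nonneg_left (hgh w hw h0) h0.le

lemma mul_le_iterExp (hP : ∀ a, ∀ w ∈ θ a, 0 ≤ P a w) (n : ℕ) (u w : List A)
    {g : List A → ℝ} (hg : ∀ v, 0 ≤ g v) :
    iterProb θ P n u w * g w ≤ iterExp θ P n u g := by
  by_cases hw : w ∈ realsIter θ n u
  · exact Finset.single_le_sum (f := fun v => iterProb θ P n u v * g v)
      (fun v _ => mul_nonneg (iterProb_nonneg hP n u v) (hg v)) hw
  · rw [iterProb_eq_zero hw, zero_mul]
    exact Finset.sum_nonneg fun v _ => mul_nonneg (iterProb_nonneg hP n u v) (hg v)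

lemma wordExp_const (hP1 : ∀ a, ∑ w ∈ θ a, P a w = 1) (u : List A) (t : ℝ) :
    wordExp θ P u (fun _ => t) = t := by
  induction u with
  | nil => simp [wordExp, reals, wordProb]
  | cons a u ih => rw [wordExp_cons, ih, ← Finset.sum_mul, hP1, one_mul]

lemma iterExp_const (hP1 : ∀ a, ∑ w ∈ θ a, P a w = 1) (n : ℕ) (u : List A) (t : ℝ) :
    iterExp θ P n u (fun _ => t) = t := by
  induction n generalizing u with
  | zero => rw [iterExp_zero]
  | succ n ih => simp only [iterExp_succ, ih, wordExp_const hP1]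

lemma sum_iterProb_le_one (hP : ∀ a, ∀ w ∈ θ a, 0 ≤ P a w) (hP1 : ∀ a, ∑ w ∈ θ a, P a w = 1)
    (n : ℕ) (u : List A) (s : Finset (List A)) : ∑ w ∈ s, iterProb θ P n u w ≤ 1 := by
  have htotal : ∑ w ∈ realsIter θ n u, iterProb θ P n u w = 1 := by
    simpa [iterExp] using iterExp_const hP1 n u 1
  rw [← htotal, ← Finset.sum_filter_add_sum_filter_not s (· ∈ realsIter θ n u),
    Finset.sum_eq_zero (s := s.filter (· ∉ realsIter θ n u))
      fun w hw => iterProb_eq_zero (Finset.mem_filter.1 hw).2, add_zero]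
  exact Finset.sum_le_sum_of_subset_of_nonneg (fun w hw => (Finset.mem_filter.1 hw).2)
    fun w _ _ => iterProb_nonneg hP n u w

lemma iterProb_le_one (hP : ∀ a, ∀ w ∈ θ a, 0 ≤ P a w) (hP1 : ∀ a, ∑ w ∈ θ a, P a w = 1)
    (n : ℕ) (u w : List A) : iterProb θ P n u w ≤ 1 := by
  simpa using sum_iterProb_le_one hP hP1 n u {w}

lemma iterExp_letterSum (hP1 : ∀ a, ∑ w ∈ θ a, P a w = 1) (n : ℕ) (φ : A → ℝ) (v : List A) :
    iterExp θ P n v (letterSum φ) = letterSum (fun b => iterExp θ P n [b] (letterSum φ)) v := by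
  induction v with
  | nil => simp [iterExp_nil, letterSum]
  | cons b v ih =>
    have hsplit : ∀ x y : List A, letterSum φ (x ++ y) = letterSum φ x + letterSum φ y := by
      simp [letterSum]
    rw [iterExp_cons]
    simp only [hsplit, iterExp_add_fun, iterExp_const hP1, ih]
    simp [letterSum]

lemma wordExp_singleton_letterSum (a : A) (φ : A → ℝ) :
    wordExp θ P [a] (letterSum φ) = ∑ b, substM θ P b a * φ b := by
  have hcount : ∀ w : List A, letterSum φ w = ∑ b, (w.count b : ℝ) * φ b := by
    intro w
    induction w with
    | nil => simp [letterSum]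
    | cons x w ih =>
      have : letterSum φ (x :: w) = φ x + letterSum φ w := by simp [letterSum]
      rw [this, ih]
      simp [List.count_cons, add_mul, Finset.sum_add_distrib, add_comm]
  rw [wordExp_cons]
  simp only [wordExp, reals, wordProb, Finset.sum_singleton, if_true, one_mul, List.append_nil,
    hcount, substM, Matrix.of_apply, Finset.sum_mul, Finset.mul_sum]
  rw [Finset.sum_comm]
  simp only [mul_assoc]

/-- Starting from a random letter distributed according to the eigenvector, additive
functionals grow exactly by the factor `lam` in every step. -/
lemma sum_eigenvector_mul_iterExp_letterSum (hP1 : ∀ a, ∑ w ∈ θ a, P a w = 1)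
    {lam : ℝ} {R : A → ℝ} (hEig : (substM θ P).mulVec R = lam • R) (n : ℕ) (φ : A → ℝ) :
    ∑ a, R a * iterExp θ P n [a] (letterSum φ) = lam ^ n * ∑ a, R a * φ a := by
  induction n with
  | zero => simp [iterExp_zero, letterSum]
  | succ n ih =>
    have hstep : ∀ b, ∑ a, substM θ P b a * R a = lam * R b := fun b => by
      simpa [Matrix.mulVec, dotProduct] using congrFun hEig b
    calc ∑ a, R a * iterExp θ P (n + 1) [a] (letterSum φ)
        = ∑ a, R a * ∑ b, substM θ P b a * iterExp θ P n [b] (letterSum φ) := by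
          simp only [iterExp_succ]
          refine Finset.sum_congr rfl fun a _ => ?_
          rw [← wordExp_singleton_letterSum]
          congr 2
          funext v
          exact iterExp_letterSum hP1 n φ v
      _ = ∑ b, (∑ a, substM θ P b a * R a) * iterExp θ P n [b] (letterSum φ) := by
          simp only [Finset.mul_sum, Finset.sum_mul]
          rw [Finset.sum_comm]
          exact Finset.sum_congr rfl fun b _ => Finset.sum_congr rfl fun a _ => by ring
      _ = lam ^ (n + 1) * ∑ a, R a * φ a := by
          simp only [hstep, mul_assoc, ← Finset.mul_sum, ih, pow_succ']

/-- If `g` is bounded by a sum of block costs along every concatenation of level-`n` inflation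
words, then so is its expectation. -/
lemma iterExp_le_of_flatten_le (hP : ∀ a, ∀ w ∈ θ a, 0 ≤ P a w)
    (hP1 : ∀ a, ∑ w ∈ θ a, P a w = 1) {n : ℕ} (h : List A → ℝ) (v : List A) (g : List A → ℝ)
    (t : ℝ) (hg : ∀ us : List (List A), (∀ u ∈ us, ∃ b, u ∈ realsIter θ n [b]) →
      g us.flatten ≤ t + (us.map h).sum) :
    iterExp θ P n v g ≤ t + letterSum (fun b => iterExp θ P n [b] h) v := by
  induction v generalizing g t with
  | nil =>
    simpa [iterExp_nil, letterSum] using hg [] (by simp)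
  | cons b v ih =>
    rw [iterExp_cons]
    calc iterExp θ P n [b] (fun x => iterExp θ P n v fun y => g (x ++ y))
        ≤ iterExp θ P n [b] (fun x =>
            (t + letterSum (fun b => iterExp θ P n [b] h) v) + h x) := by
          refine iterExp_mono hP fun x hx _ => ?_
          have := ih (fun y => g (x ++ y)) (t + h x) fun us hus => by
            have := hg (x :: us) (by
              intro u hu
              rcases List.mem_cons.1 hu with rfl | hu
              · exact ⟨b, hx⟩
              · exact hus u hu)
            simpa [add_assoc] using this
          linarith
      _ = t + letterSum (fun b => iterExp θ P n [b] h) (b :: v) := by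
          rw [iterExp_add_fun, iterExp_const hP1]
          simp only [letterSum, List.map_cons, List.sum_cons]
          ring

lemma Hvec_eq_iterExp (n : ℕ) (a : A) :
    Hvec θ P n a = iterExp θ P n [a] fun w => -Real.log (iterProb θ P n [a] w) := by
  simp [Hvec, iterExp, Real.negMulLog]

lemma iterProb_mul_iterProb_le_append (hP : ∀ a, ∀ w ∈ θ a, 0 ≤ P a w) (n : ℕ)
    (u v x y : List A) :
    iterProb θ P n u x * iterProb θ P n v y ≤ iterProb θ P n (u ++ v) (x ++ y) := by
  rw [iterProb_eq_iterExp n (u ++ v), iterExp_append]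
  have hnonneg : ∀ x', 0 ≤ iterExp θ P n v fun y' => if x' ++ y' = x ++ y then (1 : ℝ) else 0 :=
    fun x' => Finset.sum_nonneg fun y' _ =>
      mul_nonneg (iterProb_nonneg hP n v y') (by dsimp only; split_ifs <;> norm_num)
  refine le_trans (mul_le_mul_of_nonneg_left ?_ (iterProb_nonneg hP n u x))
    (mul_le_iterExp hP n u x hnonneg)
  simpa using mul_le_iterExp hP n v y
    (g := fun y' => if x ++ y' = x ++ y then (1 : ℝ) else 0) (fun _ => by split_ifs <;> norm_num)

lemma iterProb_mul_iterProb_le_add (hP : ∀ a, ∀ w ∈ θ a, 0 ≤ P a w) (m n : ℕ)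
    (u v w : List A) :
    iterProb θ P m u v * iterProb θ P n v w ≤ iterProb θ P (m + n) u w := by
  rw [iterProb_eq_iterExp (m + n), iterExp_add]
  simp only [← iterProb_eq_iterExp]
  exact mul_le_iterExp hP m u v fun v' => iterProb_nonneg hP n v' w

lemma neg_log_le_add_of_mul_le {x y z : ℝ} (hx : 0 < x) (hy : 0 < y) (h : x * y ≤ z) :
    -Real.log z ≤ -Real.log x + -Real.log y := by
  have := Real.log_le_log (mul_pos hx hy) h
  rw [Real.log_mul hx.ne' hy.ne'] at this
  linarith

/-- The entropy of the image of a word is at most the sum of the entropies of the images of its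
letters. -/
lemma iterExp_neg_log_iterProb_le (hP : ∀ a, ∀ w ∈ θ a, 0 ≤ P a w)
    (hP1 : ∀ a, ∑ w ∈ θ a, P a w = 1) (n : ℕ) (v : List A) :
    iterExp θ P n v (fun w => -Real.log (iterProb θ P n v w)) ≤ letterSum (Hvec θ P n) v := by
  induction v with
  | nil => simp [iterExp_nil, letterSum, iterProb_eq_iterExp]
  | cons b v ih =>
    rw [iterExp_cons]
    calc iterExp θ P n [b] (fun x => iterExp θ P n v fun y =>
            -Real.log (iterProb θ P n (b :: v) (x ++ y)))
        ≤ iterExp θ P n [b] (fun x => iterExp θ P n v fun y =>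
            -Real.log (iterProb θ P n [b] x) + -Real.log (iterProb θ P n v y)) :=
          iterExp_mono hP fun x _ hx => iterExp_mono hP fun y _ hy =>
            neg_log_le_add_of_mul_le hx hy (iterProb_mul_iterProb_le_append hP n [b] v x y)
      _ ≤ letterSum (Hvec θ P n) (b :: v) := by
          simp only [iterExp_add_fun, iterExp_const hP1, ← Hvec_eq_iterExp]
          simpa [letterSum] using ih

lemma Hvec_add_le (hP : ∀ a, ∀ w ∈ θ a, 0 ≤ P a w) (hP1 : ∀ a, ∑ w ∈ θ a, P a w = 1)
    (m n : ℕ) (a : A) :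
    Hvec θ P (m + n) a ≤ Hvec θ P m a + iterExp θ P m [a] (letterSum (Hvec θ P n)) := by
  rw [Hvec_eq_iterExp, Hvec_eq_iterExp m, ← iterExp_add_fun, iterExp_add]
  refine iterExp_mono hP fun v _ hv => ?_
  calc iterExp θ P n v (fun w => -Real.log (iterProb θ P (m + n) [a] w))
      ≤ iterExp θ P n v (fun w =>
          -Real.log (iterProb θ P m [a] v) + -Real.log (iterProb θ P n v w)) :=
        iterExp_mono hP fun w _ hw =>
          neg_log_le_add_of_mul_le hv hw (iterProb_mul_iterProb_le_add hP m n [a] v w)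
    _ ≤ -Real.log (iterProb θ P m [a] v) + letterSum (Hvec θ P n) v := by
        rw [iterExp_add_fun, iterExp_const hP1]
        exact add_le_add_right (iterExp_neg_log_iterProb_le hP hP1 n v) _

lemma HdotR_add_le (hP : ∀ a, ∀ w ∈ θ a, 0 ≤ P a w) (hP1 : ∀ a, ∑ w ∈ θ a, P a w = 1)
    {lam : ℝ} {R : A → ℝ} (hR : ∀ a, 0 ≤ R a) (hEig : (substM θ P).mulVec R = lam • R)
    (m n : ℕ) :
    HdotR θ P R (m + n) ≤ HdotR θ P R m + lam ^ m * HdotR θ P R n := by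
  have hsum := sum_eigenvector_mul_iterExp_letterSum hP1 hEig m (Hvec θ P n)
  calc HdotR θ P R (m + n)
      ≤ ∑ a, (Hvec θ P m a * R a + R a * iterExp θ P m [a] (letterSum (Hvec θ P n))) := by
        refine Finset.sum_le_sum fun a _ => ?_
        have := mul_le_mul_of_nonneg_right (Hvec_add_le hP hP1 m n a) (hR a)
        linarith
    _ = HdotR θ P R m + lam ^ m * HdotR θ P R n := by
        rw [Finset.sum_add_distrib, hsum]
        simp only [HdotR, mul_comm]

lemma HdotR_mul_le (hP : ∀ a, ∀ w ∈ θ a, 0 ≤ P a w) (hP1 : ∀ a, ∑ w ∈ θ a, P a w = 1)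
    {lam : ℝ} {R : A → ℝ} (hlam : 1 ≤ lam) (hR : ∀ a, 0 ≤ R a)
    (hEig : (substM θ P).mulVec R = lam • R) (k j : ℕ) :
    HdotR θ P R (k * j) * (lam ^ k - 1) ≤ HdotR θ P R k * (lam ^ (k * j) - 1) := by
  induction j with
  | zero => simp [HdotR, Hvec, realsIter, iterProb]
  | succ j ih =>
    have hpow : 0 ≤ lam ^ k - 1 := sub_nonneg.2 (one_le_pow₀ hlam)
    have hstep := mul_le_mul_of_nonneg_right (HdotR_add_le hP hP1 hR hEig (k * j) k) hpow
    rw [Nat.mul_succ, pow_add]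
    linarith

end Expectation

/-- The total weight of all factorisations of a word into nonempty blocks, a factorisation being
weighted by the product of the weights of its blocks. -/
noncomputable def parseWeight {A : Type*} (T : List A → ℝ) : List A → ℝ
  | [] => 1
  | a :: v => ∑ i ∈ Finset.range (v.length + 1),
      T (a :: v.take i) * parseWeight T (v.drop i)
termination_by v => v.length
decreasing_by simp only [List.length_drop, List.length_cons]; omega

section Coding

variable {B : Type*} {T : List B → ℝ}

lemma parseWeight_nonneg (hT : ∀ u, 0 ≤ T u) (v : List B) : 0 ≤ parseWeight T v := by
  induction v using parseWeight.induct with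
  | case1 => simp [parseWeight]
  | case2 a v ih =>
    rw [parseWeight]
    exact Finset.sum_nonneg fun i _ => mul_nonneg (hT _) (ih i)

lemma parseWeight_mul_le_append (hT : ∀ u, 0 ≤ T u) (u v : List B) :
    parseWeight T u * parseWeight T v ≤ parseWeight T (u ++ v) := by
  induction u using parseWeight.induct with
  | case1 => simp [parseWeight]
  | case2 a u ih =>
    rw [List.cons_append, parseWeight, parseWeight, Finset.sum_mul]
    calc ∑ i ∈ Finset.range (u.length + 1),
          T (a :: u.take i) * parseWeight T (u.drop i) * parseWeight T v
        ≤ ∑ i ∈ Finset.range (u.length + 1),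
          T (a :: (u ++ v).take i) * parseWeight T ((u ++ v).drop i) := by
          refine Finset.sum_le_sum fun i hi => ?_
          have hi : i ≤ u.length := Nat.lt_succ_iff.1 (Finset.mem_range.1 hi)
          rw [mul_assoc, List.take_append_of_le_length hi, List.drop_append_of_le_length hi]
          exact mul_le_mul_of_nonneg_left (ih i) (hT _)
      _ ≤ _ := by
          refine Finset.sum_le_sum_of_subset_of_nonneg ?_ fun i _ _ =>
            mul_nonneg (hT _) (parseWeight_nonneg hT _)
          simp

lemma le_parseWeight (hT : ∀ u, 0 ≤ T u) (a : B) (v : List B) :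
    T (a :: v) ≤ parseWeight T (a :: v) := by
  rw [parseWeight]
  have := Finset.single_le_sum
    (f := fun i => T (a :: v.take i) * parseWeight T (v.drop i))
    (fun i _ => mul_nonneg (hT _) (parseWeight_nonneg hT _))
    (Finset.self_mem_range_succ v.length)
  simpa [parseWeight] using this

lemma parseWeight_pos (hT : ∀ u, 0 ≤ T u) (hT1 : ∀ a, 0 < T [a]) (v : List B) :
    0 < parseWeight T v := by
  induction v with
  | nil => simp [parseWeight]
  | cons a v ih =>
    exact (mul_pos ((hT1 a).trans_le (le_parseWeight hT a [])) ih).trans_le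
      (parseWeight_mul_le_append hT [a] v)

lemma neg_log_parseWeight_append_le (hT : ∀ u, 0 ≤ T u) (hT1 : ∀ a, 0 < T [a])
    (u v : List B) : -Real.log (parseWeight T (u ++ v)) ≤
      -Real.log (parseWeight T u) + -Real.log (parseWeight T v) :=
  neg_log_le_add_of_mul_le (parseWeight_pos hT hT1 u) (parseWeight_pos hT hT1 v)
    (parseWeight_mul_le_append hT u v)

lemma neg_log_parseWeight_le (hT : ∀ u, 0 ≤ T u) {τ : ℝ} (hτ : 0 < τ) (hT1 : ∀ a, τ ≤ T [a])
    (v : List B) : -Real.log (parseWeight T v) ≤ v.length * -Real.log τ := by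
  induction v with
  | nil => simp [parseWeight]
  | cons a v ih =>
    have happ := neg_log_parseWeight_append_le hT (fun a => hτ.trans_le (hT1 a)) [a] v
    have hlog := Real.log_le_log hτ ((hT1 a).trans (le_parseWeight hT a []))
    simp only [List.singleton_append, List.length_cons] at happ ⊢
    push_cast
    linarith

lemma mem_allWords [Fintype B] [DecidableEq B] {n : ℕ} {v : List B} :
    v ∈ allWords B n ↔ v.length = n := by
  simp only [allWords, Finset.mem_image, Finset.mem_univ, true_and]
  constructor
  · rintro ⟨f, rfl⟩
    simp
  · rintro rfl
    exact ⟨v.get, List.ofFn_get v⟩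

lemma sum_allWords_add [Fintype B] [DecidableEq B] (i j : ℕ) (F : List B → List B → ℝ) :
    ∑ v ∈ allWords B (i + j), F (v.take i) (v.drop i) =
      ∑ u ∈ allWords B i, ∑ v ∈ allWords B j, F u v := by
  rw [← Finset.sum_product']
  refine Finset.sum_bij' (fun v _ => (v.take i, v.drop i)) (fun p _ => p.1 ++ p.2) ?_ ?_ ?_ ?_ ?_
  · intro v hv
    simp only [mem_allWords, Finset.mem_product, List.length_take, List.length_drop] at hv ⊢
    omega
  · intro p hp
    simp only [mem_allWords, Finset.mem_product, List.length_append] at hp ⊢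
    omega
  · simp
  · rintro ⟨u, v⟩ hp
    obtain ⟨rfl, -⟩ := by simpa only [mem_allWords, Finset.mem_product] using hp
    simp
  · simp

/-- A Kraft inequality: if block weights sum up to at most `1`, then so do the weights of the
words of any given length. -/
lemma sum_parseWeight_le_one [Fintype B] [DecidableEq B] (hT : ∀ u, 0 ≤ T u)
    (hsum : ∀ N, ∑ i ∈ Finset.range N, ∑ u ∈ allWords B (i + 1), T u ≤ 1) (N : ℕ) :
    ∑ v ∈ allWords B N, parseWeight T v ≤ 1 := by
  induction N using Nat.strong_induction_on with
  | _ N ih =>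
    cases N with
    | zero =>
      have : allWords B 0 = {[]} := by ext v; simp [mem_allWords]
      simp [this, parseWeight]
    | succ N =>
      have hunfold : ∀ v ∈ allWords B (N + 1), parseWeight T v =
          ∑ i ∈ Finset.range (N + 1), T (v.take (i + 1)) * parseWeight T (v.drop (i + 1)) := by
        intro v hv
        rw [mem_allWords] at hv
        cases v with
        | nil => simp at hv
        | cons a v =>
          rw [parseWeight, ← hv]
          simp
      rw [Finset.sum_congr rfl hunfold, Finset.sum_comm]
      refine le_trans (Finset.sum_le_sum fun i hi => ?_) (hsum (N + 1))
      have hi : i + 1 ≤ N + 1 := Finset.mem_range.1 hi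
      obtain ⟨j, hj⟩ := Nat.exists_eq_add_of_le hi
      rw [hj, sum_allWords_add (i + 1) j fun u v => T u * parseWeight T v]
      simp only [← Finset.mul_sum]
      rw [← Finset.sum_mul]
      exact mul_le_of_le_one_right (Finset.sum_nonneg fun u _ => hT u) (ih j (by omega))

lemma parseWeight_le_one [Fintype B] [DecidableEq B] (hT : ∀ u, 0 ≤ T u)
    (hsum : ∀ N, ∑ i ∈ Finset.range N, ∑ u ∈ allWords B (i + 1), T u ≤ 1) (v : List B) :
    parseWeight T v ≤ 1 :=
  (Finset.single_le_sum (fun u _ => parseWeight_nonneg hT u) (mem_allWords.2 rfl)).trans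
    (sum_parseWeight_le_one hT hsum v.length)

/-- Gibbs' inequality. -/
lemma sum_negMulLog_le {ι : Type*} (s : Finset ι) (f q : ι → ℝ) (hf : ∀ i ∈ s, 0 ≤ f i)
    (hq : ∀ i ∈ s, 0 < q i) :
    ∑ i ∈ s, Real.negMulLog (f i) ≤ ∑ i ∈ s, f i * -Real.log (q i) + ∑ i ∈ s, q i := by
  rw [← Finset.sum_add_distrib]
  refine Finset.sum_le_sum fun i hi => ?_
  rcases (hf i hi).eq_or_lt with h0 | h0
  · simpa [← h0] using (hq i hi).le
  · have hlog := Real.log_le_sub_one_of_pos (div_pos (hq i hi) h0)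
    rw [Real.log_div (hq i hi).ne' h0.ne'] at hlog
    have := mul_le_mul_of_nonneg_left hlog h0.le
    rw [mul_sub, mul_sub, mul_div_cancel₀ _ h0.ne'] at this
    simp only [Real.negMulLog]
    linarith

/-- The cost of a block, carried by its first position. -/
def blockCosts (c : List B → ℝ) : List B → List ℝ
  | [] => []
  | a :: v => c (a :: v) :: List.replicate v.length 0

lemma length_blockCosts (c : List B → ℝ) (u : List B) : (blockCosts c u).length = u.length := by
  cases u <;> simp [blockCosts]

lemma sum_blockCosts {c : List B → ℝ} (hnil : c [] = 0) (u : List B) :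
    (blockCosts c u).sum = c u := by
  cases u <;> simp [blockCosts, hnil]

lemma blockCosts_nonneg {c : List B → ℝ} (hc : ∀ u, 0 ≤ c u) (u : List B) :
    ∀ x ∈ blockCosts c u, 0 ≤ x := by
  cases u with
  | nil => simp [blockCosts]
  | cons a v =>
    intro x hx
    rcases List.mem_cons.1 hx with rfl | hx
    · exact hc _
    · exact (List.eq_of_mem_replicate hx).ge

lemma sum_take_nonneg {D : List ℝ} (hD : ∀ x ∈ D, 0 ≤ x) (N : ℕ) : 0 ≤ (D.take N).sum :=
  List.sum_nonneg fun x hx => hD x (List.mem_of_mem_take hx)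

lemma sum_range_sum_take_drop_le {D : List ℝ} (hD : ∀ x ∈ D, 0 ≤ x) (N : ℕ) :
    ∑ i ∈ Finset.range D.length, ((D.drop i).take N).sum ≤ N * D.sum := by
  induction N with
  | zero => simp
  | succ N ih =>
    have hstep : ∀ i ∈ Finset.range D.length, ((D.drop i).take (N + 1)).sum =
        D.getD i 0 + ((D.drop (i + 1)).take N).sum := by
      intro i hi
      have hi : i < D.length := Finset.mem_range.1 hi
      rw [List.drop_eq_getElem_cons hi, List.take_succ_cons, List.sum_cons,
        List.getD_eq_getElem _ _ hi]
    have hsum : ∑ i ∈ Finset.range D.length, D.getD i 0 = D.sum := by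
      rw [Finset.sum_range, ← Fin.sum_univ_getElem]
      simp
    have hshift := Finset.sum_range_succ (fun i => ((D.drop i).take N).sum) D.length
    rw [Finset.sum_range_succ'] at hshift
    have hnonneg := sum_take_nonneg (D := D.drop 0) (fun x hx => hD x (List.mem_of_mem_drop hx)) N
    simp only [List.drop_length, List.take_nil, List.sum_nil] at hshift
    rw [Finset.sum_congr rfl hstep, Finset.sum_add_distrib, hsum]
    push_cast
    linarith

variable {c : List B → ℝ} {κ : ℝ} {L : ℕ}

lemma cost_take_flatten_le (hc : ∀ u, 0 ≤ c u) (happ : ∀ u v, c (u ++ v) ≤ c u + c v)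
    (hlen : ∀ u, c u ≤ u.length * κ) (hκ : 0 ≤ κ) (us : List (List B))
    (hus : ∀ u ∈ us, u.length ≤ L) (N : ℕ) :
    c (us.flatten.take N) ≤ ((us.flatMap (blockCosts c)).take N).sum + L * κ := by
  have hnil : c [] = 0 := le_antisymm (by simpa using hlen []) (hc [])
  induction us generalizing N with
  | nil => simpa [hnil] using mul_nonneg (Nat.cast_nonneg L) hκ
  | cons u us ih =>
    have hD : ∀ x ∈ (u :: us).flatMap (blockCosts c), 0 ≤ x := by
      intro x hx
      obtain ⟨v, -, hv⟩ := List.mem_flatMap.1 hx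
      exact blockCosts_nonneg hc v x hv
    rcases le_total u.length N with h | h
    · rw [List.flatten_cons, List.flatMap_cons, List.take_append, List.take_append,
        List.take_of_length_le h,
        List.take_of_length_le ((length_blockCosts c u).trans_le h), length_blockCosts, List.sum_append, sum_blockCosts hnil]
      have := ih (fun v hv => hus v (List.mem_cons_of_mem _ hv)) (N - u.length)
      linarith [happ u (us.flatten.take (N - u.length))]
    · rw [List.flatten_cons, List.take_append_of_le_length h]
      have hle : ((u.take N).length : ℝ) ≤ L := by
        exact_mod_cast (List.length_take_le' N u).trans (hus u List.mem_cons_self)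
      linarith [hlen (u.take N), mul_le_mul_of_nonneg_right hle hκ, sum_take_nonneg hD N]

lemma cost_window_flatten_le (hc : ∀ u, 0 ≤ c u) (happ : ∀ u v, c (u ++ v) ≤ c u + c v)
    (hlen : ∀ u, c u ≤ u.length * κ) (hκ : 0 ≤ κ) (us : List (List B))
    (hus : ∀ u ∈ us, u.length ≤ L) (N i : ℕ) :
    c ((us.flatten.drop i).take N) ≤
      (((us.flatMap (blockCosts c)).drop i).take N).sum + 2 * L * κ := by
  have hnil : c [] = 0 := le_antisymm (by simpa using hlen []) (hc [])
  have hLκ : 0 ≤ L * κ := mul_nonneg (Nat.cast_nonneg L) hκ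
  induction us generalizing i with
  | nil =>
    simp only [List.flatten_nil, List.drop_nil, List.take_nil, hnil, List.flatMap_nil,
      List.sum_nil]
    linarith
  | cons u us ih =>
    have hus' : ∀ v ∈ us, v.length ≤ L := fun v hv => hus v (List.mem_cons_of_mem _ hv)
    rw [List.flatten_cons, List.flatMap_cons, List.drop_append, List.drop_append,
      length_blockCosts]
    rcases le_total u.length i with h | h
    · rw [List.drop_eq_nil_of_le h,
        List.drop_eq_nil_of_le ((length_blockCosts c u).trans_le h)]
      simpa using ih hus' (i - u.length)
    · have hlt : i - u.length = 0 := by omega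
      rw [hlt, List.drop_zero, List.drop_zero, List.take_append, List.take_append,
        List.sum_append, List.length_drop, List.length_drop, length_blockCosts]
      have htail := cost_take_flatten_le hc happ hlen hκ us hus' (N - (u.length - i))
      have hfirst := sum_take_nonneg (D := (blockCosts c u).drop i)
        (fun x hx => blockCosts_nonneg hc u x (List.mem_of_mem_drop hx)) N
      have hle : (((u.drop i).take N).length : ℝ) ≤ L := by
        have := hus u List.mem_cons_self
        simp only [List.length_take, List.length_drop]
        exact_mod_cast (by omega : min N (u.length - i) ≤ L)
      linarith [happ ((u.drop i).take N) (us.flatten.take (N - (u.length - i))),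
        hlen ((u.drop i).take N), mul_le_mul_of_nonneg_right hle hκ]

/-- The total cost of all windows of length `N` in a concatenation of blocks: each block lies in
at most `N` windows, and only the two blocks at the boundary of a window are paid letterwise. -/
lemma sum_cost_windows_flatten_le (hc : ∀ u, 0 ≤ c u) (happ : ∀ u v, c (u ++ v) ≤ c u + c v)
    (hlen : ∀ u, c u ≤ u.length * κ) (hκ : 0 ≤ κ) (us : List (List B))
    (hus : ∀ u ∈ us, u.length ≤ L) (N : ℕ) :
    ∑ i ∈ Finset.range us.flatten.length, c ((us.flatten.drop i).take N) ≤
      (us.map fun u => N * c u + 2 * L * κ * u.length).sum := by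
  have hnil : c [] = 0 := le_antisymm (by simpa using hlen []) (hc [])
  have hD : ∀ x ∈ us.flatMap (blockCosts c), 0 ≤ x := by
    intro x hx
    obtain ⟨v, -, hv⟩ := List.mem_flatMap.1 hx
    exact blockCosts_nonneg hc v x hv
  have hlength : us.flatten.length = (us.flatMap (blockCosts c)).length := by
    simp [List.length_flatten, List.length_flatMap, length_blockCosts]
  have hsum : (us.flatMap (blockCosts c)).sum = (us.map c).sum := by
    simp [List.flatMap, List.sum_flatten, Function.comp_def, sum_blockCosts hnil]
  have hrhs : ∀ vs : List (List B), (vs.map fun u => N * c u + 2 * L * κ * u.length).sum =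
      N * (vs.map c).sum + 2 * L * κ * vs.flatten.length := by
    intro vs
    induction vs with
    | nil => simp
    | cons u vs ih =>
      simp only [List.map_cons, List.sum_cons, ih, List.flatten_cons, List.length_append]
      push_cast
      ring
  calc ∑ i ∈ Finset.range us.flatten.length, c ((us.flatten.drop i).take N)
      ≤ ∑ i ∈ Finset.range us.flatten.length,
          ((((us.flatMap (blockCosts c)).drop i).take N).sum + 2 * L * κ) :=
        Finset.sum_le_sum fun i _ => cost_window_flatten_le hc happ hlen hκ us hus N i
    _ ≤ N * (us.map c).sum + 2 * L * κ * us.flatten.length := by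
        rw [Finset.sum_add_distrib, Finset.sum_const, Finset.card_range, nsmul_eq_mul, hlength,
          ← hsum]
        linarith [sum_range_sum_take_drop_le hD N]
    _ = _ := (hrhs us).symm

end Coding

/-- Block weights giving half of the mass to level-`n` inflation words and half to letters. -/
noncomputable def stepWeight (θ : A → Finset (List A)) (P : A → List A → ℝ) (n : ℕ)
    (u : List A) : ℝ :=
  (2 * (Fintype.card A : ℝ))⁻¹ *
    (∑ b, iterProb θ P n [b] u + if u.length = 1 then 1 else 0)

section EntropyBound

set_option linter.unusedSectionVars false

variable {θ : A → Finset (List A)} {P : A → List A → ℝ}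

lemma stepWeight_nonneg (hP : ∀ a, ∀ w ∈ θ a, 0 ≤ P a w) (n : ℕ) (u : List A) :
    0 ≤ stepWeight θ P n u :=
  mul_nonneg (by positivity) (add_nonneg
    (Finset.sum_nonneg fun b _ => iterProb_nonneg hP n [b] u) (by split_ifs <;> norm_num))

lemma le_stepWeight_singleton (hP : ∀ a, ∀ w ∈ θ a, 0 ≤ P a w) (n : ℕ) (a : A) :
    (2 * (Fintype.card A : ℝ))⁻¹ ≤ stepWeight θ P n [a] := by
  refine le_mul_of_one_le_right (by positivity) ?_
  simpa using Finset.sum_nonneg fun b (_ : b ∈ Finset.univ) => iterProb_nonneg hP n [b] [a]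

lemma mul_iterProb_le_stepWeight (hP : ∀ a, ∀ w ∈ θ a, 0 ≤ P a w) (n : ℕ) (b : A)
    (u : List A) :
    (2 * (Fintype.card A : ℝ))⁻¹ * iterProb θ P n [b] u ≤ stepWeight θ P n u := by
  refine mul_le_mul_of_nonneg_left ?_ (by positivity)
  have := Finset.single_le_sum (f := fun b => iterProb θ P n [b] u)
    (fun b _ => iterProb_nonneg hP n [b] u) (Finset.mem_univ b)
  have hite : (0 : ℝ) ≤ if u.length = 1 then 1 else 0 := by split_ifs <;> norm_num
  linarith

lemma sum_stepWeight_le_one [Nonempty A] (hP : ∀ a, ∀ w ∈ θ a, 0 ≤ P a w)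
    (hP1 : ∀ a, ∑ w ∈ θ a, P a w = 1) (n N : ℕ) :
    ∑ i ∈ Finset.range N, ∑ u ∈ allWords A (i + 1), stepWeight θ P n u ≤ 1 := by
  have hdisj : (Finset.range N : Set ℕ).PairwiseDisjoint fun i => allWords A (i + 1) := by
    intro i _ j _ hij
    refine Finset.disjoint_left.2 fun u hu hu' => hij ?_
    rw [mem_allWords] at hu hu'
    omega
  rw [← Finset.sum_biUnion hdisj]
  set U := (Finset.range N).biUnion fun i => allWords A (i + 1)
  have hblocks : ∑ u ∈ U, ∑ b, iterProb θ P n [b] u ≤ Fintype.card A := by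
    rw [Finset.sum_comm]
    refine (Finset.sum_le_sum fun b _ => sum_iterProb_le_one hP hP1 n [b] U).trans ?_
    simp
  have hletters : ∑ u ∈ U, (if u.length = 1 then (1 : ℝ) else 0) ≤ Fintype.card A := by
    rw [Finset.sum_boole]
    have hcard : (allWords A 1).card ≤ Fintype.card A :=
      Finset.card_image_le.trans (by simp)
    exact_mod_cast (Finset.card_le_card fun u hu =>
      mem_allWords.2 (Finset.mem_filter.1 hu).2).trans hcard
  have hpos : (0 : ℝ) < 2 * Fintype.card A := by
    have := Fintype.card_pos (α := A)
    positivity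
  simp only [stepWeight]
  rw [← Finset.mul_sum, Finset.sum_add_distrib, inv_mul_le_one₀ hpos]
  linarith

lemma occCount_eq_sum (v w : List A) :
    (occCount v w : ℝ) = ∑ i ∈ Finset.range w.length, if v <+: w.drop i then (1 : ℝ) else 0 := by
  rw [Finset.sum_boole, occCount]
  norm_cast

lemma occCount_le_length (v w : List A) : occCount v w ≤ w.length :=
  (List.length_filter_le _ _).trans (by simp)

lemma sum_occCount_mul_le {c : List A → ℝ} (hc : ∀ u, 0 ≤ c u) {N : ℕ} {s : Finset (List A)}
    (hs : ∀ v ∈ s, v.length = N) (w : List A) :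
    ∑ v ∈ s, (occCount v w : ℝ) * c v ≤
      ∑ i ∈ Finset.range w.length, c ((w.drop i).take N) := by
  simp only [occCount_eq_sum, Finset.sum_mul]
  rw [Finset.sum_comm]
  refine Finset.sum_le_sum fun i _ => ?_
  calc ∑ v ∈ s, (if v <+: w.drop i then (1 : ℝ) else 0) * c v
      ≤ ∑ v ∈ s, if v = (w.drop i).take N then c v else 0 := by
        refine Finset.sum_le_sum fun v hv => ?_
        by_cases h : v <+: w.drop i
        · have heq : v = (w.drop i).take N := by
            rw [← hs v hv]
            exact List.prefix_iff_eq_take.1 h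
          rw [if_pos h, if_pos heq, one_mul]
        · rw [if_neg h, zero_mul]
          split_ifs
          · exact hc v
          · exact le_rfl
    _ ≤ c ((w.drop i).take N) := by
        rw [Finset.sum_ite_eq']
        split_ifs
        · exact le_rfl
        · exact hc _

lemma expLen_eq_iterExp (k : ℕ) (a : A) :
    expLen θ P k a = iterExp θ P k [a] (letterSum fun _ => 1) := by
  simp [expLen, iterExp, letterSum]

lemma sum_eigenvector_mul_expLen (hP1 : ∀ a, ∑ w ∈ θ a, P a w = 1) {lam : ℝ} {R : A → ℝ}
    (hRsum : ∑ a, R a = 1) (hEig : (substM θ P).mulVec R = lam • R) (k : ℕ) :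
    ∑ a, R a * expLen θ P k a = lam ^ k := by
  simp only [expLen_eq_iterExp, sum_eigenvector_mul_iterExp_letterSum hP1 hEig, mul_one, hRsum]

lemma expCount_nonneg (hP : ∀ a, ∀ w ∈ θ a, 0 ≤ P a w) (k : ℕ) (a : A) (v : List A) :
    0 ≤ expCount θ P k a v :=
  Finset.sum_nonneg fun w _ => mul_nonneg (iterProb_nonneg hP k [a] w) (Nat.cast_nonneg _)

lemma expCount_le_expLen (hP : ∀ a, ∀ w ∈ θ a, 0 ≤ P a w) (k : ℕ) (a : A) (v : List A) :
    expCount θ P k a v ≤ expLen θ P k a :=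
  Finset.sum_le_sum fun w _ => mul_le_mul_of_nonneg_left
    (Nat.cast_le.2 (occCount_le_length v w)) (iterProb_nonneg hP k [a] w)

/-- Word frequencies may be computed by starting from a random letter distributed according to
the eigenvector. -/
lemma tendsto_sum_eigenvector_mul_expCount (hP : ∀ a, ∀ w ∈ θ a, 0 ≤ P a w)
    (hP1 : ∀ a, ∑ w ∈ θ a, P a w = 1) {lam : ℝ} {R : A → ℝ} (hlam : 0 < lam)
    (hR : ∀ a, 0 ≤ R a) (hRsum : ∑ a, R a = 1) (hEig : (substM θ P).mulVec R = lam • R)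
    {v : List A} {f : ℝ}
    (hf : ∀ a, Tendsto (fun k => expCount θ P k a v / expLen θ P k a) atTop (nhds f)) :
    Tendsto (fun k => (∑ a, R a * expCount θ P k a v) / lam ^ k) atTop (nhds f) := by
  have hlen : ∀ k a, 0 ≤ expLen θ P k a := fun k a =>
    (expCount_nonneg hP k a []).trans (expCount_le_expLen hP k a [])
  have hbound : Tendsto (fun k => ∑ a, |expCount θ P k a v / expLen θ P k a - f|) atTop
      (nhds 0) := by
    have : ∀ a, Tendsto (fun k => |expCount θ P k a v / expLen θ P k a - f|) atTop (nhds 0) := by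
      intro a
      simpa using ((hf a).sub_const f).abs
    simpa using tendsto_finsetSum Finset.univ fun a _ => this a
  rw [tendsto_iff_dist_tendsto_zero]
  refine squeeze_zero (fun _ => dist_nonneg) (fun k => ?_) hbound
  have hpow : 0 < lam ^ k := pow_pos hlam k
  have htotal := sum_eigenvector_mul_expLen hP1 hRsum hEig k
  have hweight : ∀ a, R a * expLen θ P k a / lam ^ k ≤ 1 := fun a => by
    rw [div_le_one hpow, ← htotal]
    exact Finset.single_le_sum (f := fun a => R a * expLen θ P k a)
      (fun b _ => mul_nonneg (hR b) (hlen k b)) (Finset.mem_univ a)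
  have hdiff : (∑ a, R a * expCount θ P k a v) / lam ^ k - f =
      ∑ a, R a * expLen θ P k a / lam ^ k * (expCount θ P k a v / expLen θ P k a - f) := by
    have hone : ∑ a, R a * expLen θ P k a / lam ^ k = 1 := by
      rw [← Finset.sum_div, htotal, div_self hpow.ne']
    simp only [mul_sub]
    rw [Finset.sum_sub_distrib, ← Finset.sum_mul, hone, one_mul, Finset.sum_div]
    congr 1
    refine Finset.sum_congr rfl fun a _ => ?_
    rcases (hlen k a).eq_or_lt with h0 | h0
    · have : expCount θ P k a v = 0 :=
        le_antisymm ((expCount_le_expLen hP k a v).trans h0.ge) (expCount_nonneg hP k a v)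
      simp [this]
    · field_simp
  rw [Real.dist_eq, hdiff]
  refine (Finset.abs_sum_le_sum_abs _ _).trans (Finset.sum_le_sum fun a _ => ?_)
  rw [abs_mul, abs_of_nonneg (div_nonneg (mul_nonneg (hR a) (hlen k a)) hpow.le)]
  exact mul_le_of_le_one_left (abs_nonneg _) (hweight a)

/-- The entropy of level-`n` inflation words bounds the block entropies of word frequencies, up
to an error that does not depend on the block length. -/
lemma exists_sum_negMulLog_le [Nonempty A] (hP : ∀ a, ∀ w ∈ θ a, 0 ≤ P a w)
    (hP1 : ∀ a, ∑ w ∈ θ a, P a w = 1) {lam : ℝ} {R : A → ℝ} (hlam : 0 < lam)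
    (hR : ∀ a, 0 ≤ R a) (hRsum : ∑ a, R a = 1) (hEig : (substM θ P).mulVec R = lam • R)
    (n : ℕ) :
    ∃ C : ℝ, ∀ (N : ℕ) (s : Finset (List A)) (f : List A → ℝ), (∀ v ∈ s, v.length = N) →
      (∀ v ∈ s, 0 ≤ f v) →
      (∀ v ∈ s, Tendsto (fun k => (∑ a, R a * expCount θ P k a v) / lam ^ k) atTop
        (nhds (f v))) →
      ∑ v ∈ s, Real.negMulLog (f v) ≤
        N * ((Real.log (2 * Fintype.card A) + HdotR θ P R n) / lam ^ n) + C := by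
  have hcard : (1 : ℝ) ≤ Fintype.card A := by
    exact_mod_cast Fintype.card_pos (α := A)
  set τ : ℝ := (2 * (Fintype.card A : ℝ))⁻¹ with hτdef
  have hτ : 0 < τ := by positivity
  have hκ : -Real.log τ = Real.log (2 * Fintype.card A) := by rw [hτdef, Real.log_inv, neg_neg]
  set κ : ℝ := Real.log (2 * Fintype.card A)
  have hκ0 : 0 ≤ κ := Real.log_nonneg (by linarith)
  have hT := stepWeight_nonneg (θ := θ) hP n
  have hTτ := le_stepWeight_singleton (θ := θ) hP n
  have hTpos : ∀ a, 0 < stepWeight θ P n [a] := fun a => hτ.trans_le (hTτ a)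
  have hTsum := sum_stepWeight_le_one (θ := θ) hP hP1 n
  set c : List A → ℝ := fun v => -Real.log (parseWeight (stepWeight θ P n) v)
  have hc : ∀ v, 0 ≤ c v := fun v => neg_nonneg.2
    (Real.log_nonpos (parseWeight_nonneg hT v) (parseWeight_le_one hT hTsum v))
  have happ : ∀ u v, c (u ++ v) ≤ c u + c v := neg_log_parseWeight_append_le hT hTpos
  have hlen : ∀ v, c v ≤ v.length * κ := fun v => by
    rw [← hκ]
    exact neg_log_parseWeight_le hT hτ hTτ v
  set L : ℕ := (Finset.univ.biUnion fun b => realsIter θ n [b]).sup List.length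
  have hL : ∀ u, (∃ b, u ∈ realsIter θ n [b]) → u.length ≤ L := fun u ⟨b, hu⟩ =>
    Finset.le_sup (f := List.length) (Finset.mem_biUnion.2 ⟨b, Finset.mem_univ b, hu⟩)
  have hblock : ∀ b, iterExp θ P n [b] c ≤ κ + Hvec θ P n b := by
    intro b
    rw [Hvec_eq_iterExp, ← iterExp_const (θ := θ) hP1 n [b] κ, ← iterExp_add_fun]
    refine iterExp_mono hP fun u _ hu => ?_
    rw [← hκ]
    refine neg_log_le_add_of_mul_le hτ hu ?_
    cases u with
    | nil =>
      have hτ1 : τ ≤ 1 := inv_le_one_of_one_le₀ (by linarith)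
      rw [parseWeight]
      exact mul_le_one₀ hτ1 hu.le (iterProb_le_one hP hP1 n [b] [])
    | cons a v =>
      exact (mul_iterProb_le_stepWeight hP n b _).trans (le_parseWeight hT a v)
  refine ⟨2 * L * κ + 1, fun N s f hs hf0 hf => ?_⟩
  have hpow : 0 < lam ^ n := pow_pos hlam n
  set E : ℝ := (κ + HdotR θ P R n) / lam ^ n with hE
  set h : List A → ℝ := fun u => N * c u + 2 * L * κ * u.length
  have hfinite : ∀ k, ∑ v ∈ s, (∑ a, R a * expCount θ P (k + n) a v) / lam ^ (k + n) * c v ≤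
      N * E + 2 * L * κ := by
    intro k
    have hletter : ∑ b, R b * iterExp θ P n [b] h ≤
        N * (κ + HdotR θ P R n) + 2 * L * κ * lam ^ n := by
      have hsplit : ∀ b, iterExp θ P n [b] h =
          N * iterExp θ P n [b] c + 2 * L * κ * expLen θ P n b := fun b =>
        iterExp_linear n [b] N (2 * L * κ) c fun u => u.length
      calc ∑ b, R b * iterExp θ P n [b] h
          ≤ ∑ b, (N * (κ * R b + Hvec θ P n b * R b) +
              2 * L * κ * (R b * expLen θ P n b)) := by
            refine Finset.sum_le_sum fun b _ => ?_
            rw [hsplit]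
            have := mul_le_mul_of_nonneg_left (hblock b)
              (mul_nonneg (Nat.cast_nonneg (α := ℝ) N) (hR b))
            linarith
        _ = N * (κ + HdotR θ P R n) + 2 * L * κ * lam ^ n := by
            rw [Finset.sum_add_distrib, ← Finset.mul_sum, ← Finset.mul_sum,
              Finset.sum_add_distrib, ← Finset.mul_sum, hRsum,
              sum_eigenvector_mul_expLen hP1 hRsum hEig, mul_one, HdotR]
    have hletters : ∀ a, ∑ v ∈ s, expCount θ P (k + n) a v * c v ≤
        iterExp θ P k [a] (letterSum fun b => iterExp θ P n [b] h) := by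
      intro a
      calc ∑ v ∈ s, expCount θ P (k + n) a v * c v
          = iterExp θ P (k + n) [a] (fun w => ∑ v ∈ s, (occCount v w : ℝ) * c v) := by
            simp only [expCount, iterExp, Finset.sum_mul, Finset.mul_sum, mul_assoc]
            exact Finset.sum_comm
        _ = iterExp θ P k [a] (fun x => iterExp θ P n x fun w =>
              ∑ v ∈ s, (occCount v w : ℝ) * c v) := iterExp_add k n [a] _
        _ ≤ _ := by
            refine iterExp_mono hP fun x _ _ => ?_
            have := iterExp_le_of_flatten_le hP hP1 h x
              (fun w => ∑ v ∈ s, (occCount v w : ℝ) * c v) 0 fun us hus => by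
                rw [zero_add]
                exact (sum_occCount_mul_le hc hs _).trans (sum_cost_windows_flatten_le hc happ
                  hlen hκ0 us (fun u hu => hL u (hus u hu)) N)
            rwa [zero_add] at this
    have hpow' : 0 < lam ^ (k + n) := pow_pos hlam _
    calc ∑ v ∈ s, (∑ a, R a * expCount θ P (k + n) a v) / lam ^ (k + n) * c v
        = (∑ a, R a * ∑ v ∈ s, expCount θ P (k + n) a v * c v) / lam ^ (k + n) := by
          simp only [Finset.mul_sum, Finset.sum_div, Finset.sum_mul]
          rw [Finset.sum_comm]
          exact Finset.sum_congr rfl fun a _ => Finset.sum_congr rfl fun v _ => by ring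
      _ ≤ (∑ a, R a * iterExp θ P k [a] (letterSum fun b => iterExp θ P n [b] h)) /
            lam ^ (k + n) := by
          refine div_le_div_of_nonneg_right (Finset.sum_le_sum fun a _ => ?_) hpow'.le
          exact mul_le_mul_of_nonneg_left (hletters a) (hR a)
      _ = (∑ b, R b * iterExp θ P n [b] h) / lam ^ n := by
          rw [sum_eigenvector_mul_iterExp_letterSum hP1 hEig, pow_add,
            mul_div_mul_left _ _ (pow_pos hlam k).ne']
      _ ≤ (N * (κ + HdotR θ P R n) + 2 * L * κ * lam ^ n) / lam ^ n :=
          div_le_div_of_nonneg_right hletter hpow.le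
      _ = N * E + 2 * L * κ := by
          rw [hE]
          field_simp
  have hlimit : ∑ v ∈ s, f v * c v ≤ N * E + 2 * L * κ := by
    refine le_of_tendsto' (x := atTop) (tendsto_finsetSum s fun v hv => ?_) hfinite
    exact ((tendsto_add_atTop_iff_nat n).2 (hf v hv)).mul_const (c v)
  have hgibbs := sum_negMulLog_le s f (parseWeight (stepWeight θ P n)) hf0
    fun v _ => parseWeight_pos hT hTpos v
  have hkraft : ∑ v ∈ s, parseWeight (stepWeight θ P n) v ≤ 1 :=
    (Finset.sum_le_sum_of_subset_of_nonneg (fun v hv => mem_allWords.2 (hs v hv))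
      fun v _ _ => parseWeight_nonneg hT v).trans (sum_parseWeight_le_one hT hTsum N)
  linarith

lemma mem_legalWords {n : ℕ} {v : List A} :
    v ∈ legalWords θ n ↔ v.length = n ∧ Legal θ v := by
  classical
  rw [legalWords, Finset.mem_filter, mem_allWords]

lemma measEntropy_le [MeasurableSpace A] [Nonempty A] {μ : Measure (ℤ → A)}
    (hP : ∀ a, ∀ w ∈ θ a, 0 ≤ P a w)
    (hP1 : ∀ a, ∑ w ∈ θ a, P a w = 1) {lam : ℝ} {R : A → ℝ} (hlam : 0 < lam)
    (hR : ∀ a, 0 ≤ R a) (hRsum : ∑ a, R a = 1) (hEig : (substM θ P).mulVec R = lam • R)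
    (hμ : IsFrequencyMeasure θ P μ) (n : ℕ) :
    measEntropy θ μ ≤ (Real.log (2 * Fintype.card A) + HdotR θ P R n) / lam ^ n := by
  obtain ⟨hprob, -, -, hfreq⟩ := hμ
  obtain ⟨C, hC⟩ := exists_sum_negMulLog_le hP hP1 hlam hR hRsum hEig n
  set E : ℝ := (Real.log (2 * Fintype.card A) + HdotR θ P R n) / lam ^ n
  have hle : ∀ N, entropySeq θ μ N ≤ N * E + C := fun N => by
    refine hC N _ _ (fun v hv => (mem_legalWords.1 hv).1)
      (fun v _ => ENNReal.toReal_nonneg) fun v hv => ?_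
    exact tendsto_sum_eigenvector_mul_expCount hP hP1 hlam hR hRsum hEig
      (hfreq v (mem_legalWords.1 hv).2 0)
  have hnonneg : ∀ N, 0 ≤ entropySeq θ μ N / N := fun N =>
    div_nonneg (Finset.sum_nonneg fun v _ => Real.negMulLog_nonneg ENNReal.toReal_nonneg
      (ENNReal.toReal_le_of_le_ofReal zero_le_one (by simpa using prob_le_one)))
      (Nat.cast_nonneg N)
  have hlim : Tendsto (fun N : ℕ => E + C / N) atTop (nhds E) := by
    simpa using tendsto_const_nhds.add (tendsto_const_div_atTop_nhds_zero_nat C)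
  rw [measEntropy, ← hlim.limsup_eq]
  refine limsup_le_limsup ?_ (isCoboundedUnder_le_of_le atTop hnonneg) hlim.isBoundedUnder_le
  filter_upwards [eventually_gt_atTop 0] with N hN
  have hN : (0 : ℝ) < N := Nat.cast_pos.2 hN
  rw [div_le_iff₀ hN, add_mul, div_mul_cancel₀ _ hN.ne']
  linarith [hle N]

end EntropyBound

theorem statement8 {A : Type*} [Fintype A] [DecidableEq A] [MeasurableSpace A]
    (θ : A → Finset (List A)) (P : A → List A → ℝ) (lam : ℝ) (R : A → ℝ)
    (μ : Measure (ℤ → A))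
    (hRS : IsRandomSubstitution θ P) (hprim : IsPrimitive θ P) (hlam : 1 < lam)
    (hRpos : ∀ a, 0 < R a) (hRsum : ∑ a, R a = 1)
    (hEig : (substM θ P).mulVec R = lam • R)
    (hμ : IsFrequencyMeasure θ P μ) :
    ∀ k : ℕ, 1 ≤ k → measEntropy θ μ ≤ HdotR θ P R k / (lam ^ k - 1) := by
  intro k hk
  have hP : ∀ a, ∀ w ∈ θ a, 0 ≤ P a w := fun a w hw => (hRS.2.2.1 a w hw).le
  have hP1 := hRS.2.2.2.2
  have hR : ∀ a, 0 ≤ R a := fun a => (hRpos a).le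
  have hlam0 : 0 < lam := zero_lt_one.trans hlam
  have hA : Nonempty A := by
    by_contra hA
    rw [not_nonempty_iff] at hA
    simp at hRsum
  have hpow : 0 < lam ^ k - 1 := sub_pos.2 (one_lt_pow₀ hlam (by omega))
  set κ : ℝ := Real.log (2 * Fintype.card A)
  set H : ℝ := HdotR θ P R k / (lam ^ k - 1) with hH
  have hbound : ∀ j : ℕ, measEntropy θ μ ≤ (κ - H) / (lam ^ k) ^ j + H := by
    intro j
    have hsub : HdotR θ P R (k * j) ≤ H * (lam ^ (k * j) - 1) := by
      rw [hH, div_mul_eq_mul_div, le_div_iff₀ hpow]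
      exact HdotR_mul_le hP hP1 hlam.le hR hEig k j
    have hpos : 0 < lam ^ (k * j) := pow_pos hlam0 _
    refine (measEntropy_le hP hP1 hlam0 hR hRsum hEig hμ (k * j)).trans ?_
    rw [← pow_mul, div_add' _ _ _ hpos.ne']
    exact div_le_div_of_nonneg_right (by linarith) hpos.le
  have hlim : Tendsto (fun j : ℕ => (κ - H) / (lam ^ k) ^ j + H) atTop (nhds H) := by
    have := (tendsto_pow_atTop_atTop_of_one_lt (sub_pos.1 hpow)).const_div_atTop (κ - H)
    simpa using this.add_const H
  exact ge_of_tendsto' hlim hbound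

end RandomSubstitutionTheory
end
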